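/- Let S be a Cu-semigroup with a chain-generating set Λ ⊆ S_≪, let s,t ∈ S and let (s_n)_n, (t_n)_n be their chain-decompositions. If s ≪ t, then s_n ≪ t_n for every n ∈ ℕ. Conversely, if s ∈ S_≪ and s_n ≪ t_n for every n ∈ ℕ, then s ≪ t. -/

import Mathlib

open Set

/-- `x` is way-below `y`. -/
def WayBelow {S : Type*} [Preorder S] (x y : S) : Prop :=
  ∀ z : ℕ → S, Monotone z → ∀ w : S, IsLUB (Set.range z) w → y ≤ w → ∃ k, x ≤ z k

/-- The set `S_≪` of elements way-below something. -/
def wbSet (S : Type*) [Preorder S] : Set S := {s | ∃ t, WayBelow s t}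

/-- `S` is an abstract Cuntz semigroup. -/
structure IsCu (S : Type*) [AddCommMonoid S] [PartialOrder S] [IsOrderedAddMonoid S] : Prop where
  zero_le : ∀ x : S, 0 ≤ x
  O1 : ∀ z : ℕ → S, Monotone z → ∃ w, IsLUB (Set.range z) w
  O2 : ∀ x : S, ∃ z : ℕ → S, (∀ n, WayBelow (z n) (z (n + 1))) ∧ IsLUB (Set.range z) x
  O3 : ∀ x' x y' y : S, WayBelow x' x → WayBelow y' y → WayBelow (x' + y') (x + y)
  O4 : ∀ x y : ℕ → S, Monotone x → Monotone y → ∀ a b : S, IsLUB (Set.range x) a →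
    IsLUB (Set.range y) b → IsLUB (Set.range fun n => x n + y n) (a + b)

/-- Generalized Cu-morphism. -/
structure IsGenCuMorphism {S T : Type*} [AddCommMonoid S] [PartialOrder S] [IsOrderedAddMonoid S] [AddCommMonoid T] [PartialOrder T] [IsOrderedAddMonoid T]
    (f : S → T) : Prop where
  map_zero : f 0 = 0
  map_add : ∀ x y, f (x + y) = f x + f y
  mono : Monotone f
  map_sup : ∀ (z : ℕ → S) (w : S), Monotone z → IsLUB (Set.range z) w →
    IsLUB (Set.range fun n => f (z n)) (f w)

/-- Cu-morphism. -/
structure IsCuMorphism {S T : Type*} [AddCommMonoid S] [PartialOrder S] [IsOrderedAddMonoid S] [AddCommMonoid T] [PartialOrder T] [IsOrderedAddMonoid T]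
    (f : S → T) extends IsGenCuMorphism f : Prop where
  map_wayBelow : ∀ x y, WayBelow x y → WayBelow (f x) (f y)

/-- A uniform basis of a Cu-semigroup. -/
structure UniformBasis (S : Type*) [AddCommMonoid S] [PartialOrder S] [IsOrderedAddMonoid S] where
  M : ℕ → Set S
  eps : ℕ → S → S
  M_zero : M 0 = {0}
  zero_mem : ∀ n, (0 : S) ∈ M n
  add_mem : ∀ n, ∀ x ∈ M n, ∀ y ∈ M n, x + y ∈ M n
  M_subset : ∀ n, M n ⊆ wbSet S
  eps_mem : ∀ n, ∀ s ∈ wbSet S, eps n s ∈ M n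
  eps_mono : ∀ n, ∀ s ∈ wbSet S, ∀ t ∈ wbSet S, s ≤ t → eps n s ≤ eps n t
  eps_superadd : ∀ n, ∀ s ∈ wbSet S, ∀ t ∈ wbSet S, eps n s + eps n t ≤ eps n (s + t)
  U1 : ∀ n, M n ⊆ M (n + 1)
  U2 : ∀ n s t, (∃ l, l + 1 < n ∧ s ∈ M l) → (∃ l, l + 1 < n ∧ t ∈ M l) →
    eps n (s + t) = eps n s + eps n t
  U3_mono : ∀ s ∈ wbSet S, ∀ n, eps n s ≤ eps (n + 1) s
  U3_wb : ∀ s ∈ wbSet S, ∀ n, WayBelow (eps n s) s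
  U3_sup : ∀ s ∈ wbSet S, IsLUB (Set.range fun n => eps n s) s
  U4 : ∀ l, ∀ s ∈ M l, ∀ n, l < n → WayBelow (eps n s) (eps (n + 1) s)

/-- Strict comparison `α ≈_Λ β` of two maps on a subset `Λ`. -/
def ApproxOn {S T : Type*} [Preorder S] [Preorder T] (α β : S → T) (Λ : Set S) : Prop :=
  ∀ g' ∈ Λ, ∀ g ∈ Λ, WayBelow g' g → WayBelow (α g') (β g) ∧ WayBelow (β g') (α g)

/-- Comparison `α ≃_Λ β` of two maps on a subset `Λ`. -/
def CompareOn {S T : Type*} [Preorder S] [Preorder T] (α β : S → T) (Λ : Set S) : Prop :=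
  ∀ g' ∈ Λ, ∀ g ∈ Λ, WayBelow g' g → α g' ≤ β g ∧ β g' ≤ α g

/-- `(s_n)` is a chain-decomposition of `x` relative to `Λ`. -/
def IsChainDecompOf {S : Type*} [AddCommMonoid S] [PartialOrder S] [IsOrderedAddMonoid S] (Λ : Set S) (s : ℕ → S) (x : S) : Prop :=
  (∀ n, s n ∈ Λ) ∧ Antitone s ∧
    IsLUB (Set.range fun k => ∑ n ∈ Finset.range k, s n) x

/-- `Λ` is a chain-generating set of `S`. -/
def IsChainGen {S : Type*} [AddCommMonoid S] [PartialOrder S] [IsOrderedAddMonoid S] (Λ : Set S) : Prop :=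
  Λ ⊆ wbSet S ∧
  (∀ s t : ℕ → S, (∀ n, s n ∈ Λ) → (∀ n, t n ∈ Λ) → Antitone s → Antitone t →
    ∀ a b : S, IsLUB (Set.range fun k => ∑ n ∈ Finset.range k, s n) a →
      IsLUB (Set.range fun k => ∑ n ∈ Finset.range k, t n) b →
      (a ≤ b ↔ ∀ n, s n ≤ t n)) ∧
  (∀ x : S, ∃ s : ℕ → S, IsChainDecompOf Λ s x)


theorem WayBelow.le' {S : Type*} [Preorder S] {x y : S} (h : WayBelow x y) : x ≤ y := by
  obtain ⟨_, hk⟩ := h (fun _ => y) monotone_const y (by simp) le_rfl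
  exact hk

theorem WayBelow.trans_le' {S : Type*} [Preorder S] {x y z : S} (h : WayBelow x y)
    (h' : y ≤ z) : WayBelow x z :=
  fun f hf w hw hz => h f hf w hw (h'.trans hz)

theorem WayBelow.le_trans' {S : Type*} [Preorder S] {x y z : S} (h' : x ≤ y)
    (h : WayBelow y z) : WayBelow x z := by
  intro f hf w hw hz
  obtain ⟨k, hk⟩ := h f hf w hw hz
  exact ⟨k, h'.trans hk⟩

section
variable {S : Type*} [AddCommMonoid S] [PartialOrder S] [IsOrderedAddMonoid S]

theorem sums_mono (hS : IsCu S) (f : ℕ → S) :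
    Monotone fun k => ∑ n ∈ Finset.range k, f n := by
  refine monotone_nat_of_le_succ fun k => ?_
  rw [Finset.sum_range_succ]
  exact le_add_of_nonneg_right (hS.zero_le _)

theorem isLUB_fin (hS : IsCu S) (f : ℕ → S) (N : ℕ) (h : ∀ n, N ≤ n → f n = 0) :
    IsLUB (Set.range fun k => ∑ n ∈ Finset.range k, f n) (∑ n ∈ Finset.range N, f n) := by
  refine ⟨?_, fun v hv => hv ⟨N, rfl⟩⟩
  rintro _ ⟨k, rfl⟩
  rcases le_total k N with hk | hk
  · exact sums_mono hS f hk
  · refine (Finset.sum_subset (Finset.range_mono hk) ?_).symm.le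
    intro n _ hn
    exact h n (by simpa using hn)

theorem chain_zero_mem (hS : IsCu S) {Λ : Set S} (hΛ : IsChainGen Λ) : (0 : S) ∈ Λ := by
  obtain ⟨e, h1, _, h3⟩ := hΛ.2.2 0
  have : e 0 ≤ 0 := by simpa using h3.1 ⟨1, rfl⟩
  rw [← le_antisymm this (hS.zero_le _)]
  exact h1 0

/-- Comparison with a finite decreasing sequence. -/
theorem chain_le_fin (hS : IsCu S) {Λ : Set S} (hΛ : IsChainGen Λ) {x : S} {f : ℕ → S}
    (hx : IsChainDecompOf Λ f x) (g : ℕ → S) (N : ℕ) (h0 : ∀ n, N ≤ n → g n = 0)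
    (hg : ∀ n, g n ∈ Λ) (ha : Antitone g) (hle : x ≤ ∑ n ∈ Finset.range N, g n) (n : ℕ) :
    f n ≤ g n :=
  (hΛ.2.1 f g hx.1 hg hx.2.1 ha _ _ hx.2.2 (isLUB_fin hS g N h0)).1 hle n

theorem chain_down (hS : IsCu S) {Λ : Set S} (hΛ : IsChainGen Λ) {x y : S} (hx : x ∈ Λ)
    (hy : y ≤ x) : y ∈ Λ := by
  obtain ⟨e, he⟩ := hΛ.2.2 y
  have h0 := chain_zero_mem hS hΛ
  have key := chain_le_fin hS hΛ he (fun n => if n < 1 then x else 0) 1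
    (fun n hn => by simp; omega) (fun n => by split_ifs <;> assumption)
    (fun a b hab => by
      try dsimp only
      split_ifs
      · exact le_rfl
      · omega
      · exact hS.zero_le _
      · exact le_rfl) (by simpa using hy)
  have hz : ∀ n, 1 ≤ n → e n = 0 := fun n hn => by
    have := key n
    rw [if_neg (by omega)] at this
    exact le_antisymm this (hS.zero_le _)
  have := he.2.2.unique (isLUB_fin hS e 1 hz)
  rw [this]
  simpa using he.1 0

theorem wb_sum (hS : IsCu S) (f g : ℕ → S) (h : ∀ n, WayBelow (f n) (g n)) (N : ℕ) :
    WayBelow (∑ n ∈ Finset.range N, f n) (∑ n ∈ Finset.range N, g n) := by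
  induction N with
  | zero => intro z _ _ _ _; exact ⟨0, by simpa using hS.zero_le _⟩
  | succ N ih =>
    rw [Finset.sum_range_succ, Finset.sum_range_succ]
    exact hS.O3 _ _ _ _ ih (h N)

theorem nsmul_lub (hS : IsCu S) (r : ℕ → S) (hr : Monotone r) (a : S)
    (h : IsLUB (Set.range r) a) (m : ℕ) : IsLUB (Set.range fun k => m • r k) (m • a) := by
  induction m with
  | zero => simp
  | succ m ih =>
    simp only [succ_nsmul]
    exact hS.O4 _ _ (fun a b hab => nsmul_le_nsmul_right (hr hab) m) hr _ _ ih h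

theorem sum_ite_range (f : ℕ → S) (n : ℕ) (c : S) (k : ℕ) :
    ∑ i ∈ Finset.range (n + k), (if i < n then f i else if i < n + k then c else 0)
      = ∑ i ∈ Finset.range n, f i + k • c := by
  rw [Finset.sum_range_add]
  congr 1
  · exact Finset.sum_congr rfl fun i hi => if_pos (by simpa using hi)
  · rw [Finset.sum_congr rfl (g := fun _ => c)]
    · simp
    · intro i hi
      rw [if_neg (by omega), if_pos (by simpa using hi)]

end

/-- Chain-decompositions and the way-below relation. -/
theorem chainGen_wayBelow
    {S : Type*} [AddCommMonoid S] [PartialOrder S] [IsOrderedAddMonoid S] (hS : IsCu S)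
    (Λ : Set S) (hΛ : IsChainGen Λ)
    (s t : S) (sn tn : ℕ → S)
    (hs : IsChainDecompOf Λ sn s) (ht : IsChainDecompOf Λ tn t) :
    (WayBelow s t → ∀ n, WayBelow (sn n) (tn n)) ∧
    (s ∈ wbSet S → (∀ n, WayBelow (sn n) (tn n)) → WayBelow s t) := by
  have h0 := chain_zero_mem hS hΛ
  constructor
  · intro hst n
    obtain ⟨r, hr, hrl⟩ := hS.O2 (tn n)
    have hrm : Monotone r := monotone_nat_of_le_succ fun k => (hr k).le'
    have hrt : ∀ k, r k ≤ tn n := fun k => hrl.1 ⟨k, rfl⟩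
    have hum : Monotone fun k => ∑ i ∈ Finset.range n, tn i + k • r k := by
      intro a b hab
      exact add_le_add_right ((nsmul_le_nsmul_right (hrm hab) a).trans
        (nsmul_le_nsmul_left (hS.zero_le _) hab)) _
    obtain ⟨w, hw⟩ := hS.O1 _ hum
    have htw : t ≤ w := by
      refine ht.2.2.2 ?_
      rintro _ ⟨m, rfl⟩
      have h1 : ∑ i ∈ Finset.range m, tn i ≤ ∑ i ∈ Finset.range n, tn i + m • tn n := by
        refine (sums_mono hS tn (Nat.le_add_left m n)).trans ?_
        try dsimp only
        rw [Finset.sum_range_add]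
        refine add_le_add_right ?_ _
        refine (Finset.sum_le_card_nsmul _ _ (tn n) ?_).trans (by simp)
        intro i _
        exact ht.2.1 (Nat.le_add_right n i)
      refine h1.trans ?_
      have h2 := hS.O4 (fun _ => ∑ i ∈ Finset.range n, tn i) (fun k => m • r k) monotone_const
        (fun a b hab => nsmul_le_nsmul_right (hrm hab) m) (∑ i ∈ Finset.range n, tn i) _ (by simp)
        (nsmul_lub hS r hrm _ hrl m)
      refine h2.2 ?_
      rintro _ ⟨k, rfl⟩
      refine le_trans ?_ (hw.1 ⟨max k m, rfl⟩)
      exact add_le_add_right ((nsmul_le_nsmul_right (hrm (le_max_left k m)) m).trans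
        (nsmul_le_nsmul_left (hS.zero_le _) (le_max_right k m))) _
    obtain ⟨k, hk⟩ := hst _ hum w hw htw
    have hk' : s ≤ ∑ i ∈ Finset.range n, tn i + (k + 1) • r k :=
      hk.trans (add_le_add_right (nsmul_le_nsmul_left (hS.zero_le _) (Nat.le_succ k)) _)
    have key := chain_le_fin hS hΛ hs
      (fun i => if i < n then tn i else if i < n + (k + 1) then r k else 0) (n + (k + 1))
      (fun i hi => by rw [if_neg (by omega), if_neg (by omega)])
      (fun i => by
        try dsimp only
        split_ifs
        · exact ht.1 i
        · exact chain_down hS hΛ (ht.1 n) (hrt k)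
        · exact h0)
      (fun a b hab => by
        try dsimp only
        split_ifs
        · exact ht.2.1 hab
        · omega
        · omega
        · exact (hrt k).trans (ht.2.1 (by omega))
        · exact le_rfl
        · omega
        · exact hS.zero_le _
        · exact hS.zero_le _
        · exact le_rfl)
      (by rw [sum_ite_range]; exact hk') n
    simp only [lt_irrefl, if_false] at key
    rw [if_pos (by omega)] at key
    exact WayBelow.le_trans' key ((hr k).trans_le' (hrt _))
  · rintro ⟨u, hu⟩ h
    obtain ⟨e, he⟩ := hΛ.2.2 u
    obtain ⟨N, hN⟩ := hu _ (sums_mono hS e) u he.2.2 le_rfl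
    have key := chain_le_fin hS hΛ hs (fun i => if i < N then e i else 0) N
      (fun i hi => if_neg (by omega))
      (fun i => by
        try dsimp only
        split_ifs
        · exact he.1 i
        · exact h0)
      (fun a b hab => by
        try dsimp only
        split_ifs
        · exact he.2.1 hab
        · omega
        · exact hS.zero_le _
        · exact le_rfl)
      (hN.trans (Finset.sum_congr rfl fun i hi => (if_pos (by simpa using hi)).symm).le)
    have hz : ∀ n, N ≤ n → sn n = 0 := fun n hn => by
      have := key n
      rw [if_neg (by omega)] at this
      exact le_antisymm this (hS.zero_le _)
    rw [hs.2.2.unique (isLUB_fin hS sn N hz)]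
    exact (wb_sum hS sn tn h N).trans_le' (ht.2.2.1 ⟨N, rfl⟩)
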